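/- With three agents, there exists a rule φ on the domain of strict demand lexicographic housing markets such that φ(≽) is a strong core allocation of ≽ for every market ≽, yet φ is not strategy-proof; hence a rule selecting from the strong core need not satisfy the conjunction of individual rationality, pair efficiency, and strategy-proofness. -/

import Mathlib

open Classical Function

/-- A strict linear order on `N`: `pref h h'` means `h` is strictly preferred to `h'`. -/
structure SLO (N : Type*) where
  pref : N → N → Prop
  trichotomous : ∀ a b, pref a b ∨ a = b ∨ pref b a
  irrefl : ∀ a, ¬ pref a a
  trans : ∀ a b c, pref a b → pref b c → pref a c

/-- A strict demand lexicographic preference: strict demand order over houses and strict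
supply order over agents, compared lexicographically demand-first. -/
structure SDemLexPref (N : Type*) where
  dem : SLO N
  sup : SLO N

variable {N : Type*}

/-- `a ≻ᵢ b` for strict demand lexicographic preferences. -/
def SDemLexPref.SPref (P : SDemLexPref N) (i : N) (a b : Equiv.Perm N) : Prop :=
  P.dem.pref (a i) (b i) ∨ (a i = b i ∧ P.sup.pref (a.symm i) (b.symm i))

/-- `a ≽ᵢ b` for strict demand lexicographic preferences (`a ∼ᵢ b` iff the allotments
coincide). -/
def SDemLexPref.WPref (P : SDemLexPref N) (i : N) (a b : Equiv.Perm N) : Prop :=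
  P.SPref i a b ∨ (a i = b i ∧ a.symm i = b.symm i)

section SProps
variable [DecidableEq N]

/-- Coalition `S` weakly blocks allocation `a` at the strict market `P`. -/
def SWeaklyBlocks (P : N → SDemLexPref N) (S : Finset N) (a : Equiv.Perm N) : Prop :=
  S.Nonempty ∧ ∃ b : Equiv.Perm N, S.image ⇑b = S ∧
    (∀ i ∈ S, (P i).WPref i b a) ∧ ∃ j ∈ S, (P j).SPref j b a

/-- `a` is a strong core allocation of the strict market `P`. -/
def SIsStrongCore (P : N → SDemLexPref N) (a : Equiv.Perm N) : Prop :=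
  ∀ S : Finset N, ¬ SWeaklyBlocks P S a

/-- `a` is individually rational at the strict market `P`. -/
def SIndRational (P : N → SDemLexPref N) (a : Equiv.Perm N) : Prop :=
  ∀ i : N, (P i).WPref i a 1

/-- `b` Pareto dominates `a` at the strict market `P`. -/
def SParetoDom (P : N → SDemLexPref N) (b a : Equiv.Perm N) : Prop :=
  (∀ i : N, (P i).WPref i b a) ∧ ∃ j : N, (P j).SPref j b a

/-- `a` is Pareto efficient at the strict market `P`. -/
def SParetoEff (P : N → SDemLexPref N) (a : Equiv.Perm N) : Prop :=
  ¬ ∃ b : Equiv.Perm N, SParetoDom P b a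

/-- `a` is pair efficient at the strict market `P`. -/
def SPairEff (P : N → SDemLexPref N) (a : Equiv.Perm N) : Prop :=
  ¬ ∃ i j : N, i ≠ j ∧ (P i).SPref i (a * Equiv.swap i j) a ∧
    (P j).SPref j (a * Equiv.swap i j) a ∧ SParetoDom P (a * Equiv.swap i j) a

/-- `a` is pairwise stable at the strict market `P`. -/
def SPairwiseStable (P : N → SDemLexPref N) (a : Equiv.Perm N) : Prop :=
  ¬ ∃ i j : N, i ≠ j ∧ (P i).SPref i (a * Equiv.swap i j) a ∧
    (P j).SPref j (a * Equiv.swap i j) a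

/-- `a` is stable at the strict market `P`. -/
def SStable (P : N → SDemLexPref N) (a : Equiv.Perm N) : Prop :=
  ¬ ∃ (b : Equiv.Perm N) (S : Finset N), S.Nonempty ∧ (∀ k ∉ S, b k = a k) ∧
      S.image ⇑b = S.image ⇑a ∧ ∀ i ∈ S, (P i).SPref i b a

end SProps

section StrongCoreExistence

/-- A strict linear order on a finite type has a greatest element on every nonempty set. -/
theorem SLO.exists_top [Finite N] (r : SLO N) {R : Finset N} (hR : R.Nonempty) :
    ∃ t ∈ R, ∀ x ∈ R, x = t ∨ r.pref t x := by
  have : IsTrans N r.pref := ⟨r.trans⟩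
  have : Std.Irrefl r.pref := ⟨r.irrefl⟩
  obtain ⟨t, ht, hmin⟩ :=
    (Finite.wellFounded_of_trans_of_irrefl r.pref).has_min (R : Set N) hR
  refine ⟨t, ht, fun x hx => ?_⟩
  rcases r.trichotomous x t with h | h | h
  · exact absurd h (hmin x hx)
  · exact .inl h
  · exact .inr h

/-- Top trading cycles: for every submarket `R` there is an allocation within `R` that no
coalition inside `R` can weakly improve upon with respect to demand preferences alone. -/
theorem exists_demand_core [Finite N] (dem : N → SLO N) (R : Finset N) :
    ∃ a : Equiv.Perm N, (∀ i ∉ R, a i = i) ∧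
      ∀ (S : Finset N) (b : Equiv.Perm N), S ⊆ R → (∀ i ∈ S, b i ∈ S) →
        (∀ i ∈ S, b i = a i ∨ (dem i).pref (b i) (a i)) → ∀ i ∈ S, b i = a i := by
  induction R using Finset.strongInduction with
  | H R ih =>
  rcases R.eq_empty_or_nonempty with rfl | hR
  · refine ⟨1, fun _ _ => rfl, fun S b hS _ _ i hi => absurd (hS hi) (by simp)⟩
  choose f hfR hftop using fun i => (dem i).exists_top hR
  -- All the top trading cycles are cleared simultaneously.
  have hbij := Function.bijOn_periodicPts f
  have hCR : ∀ i ∈ periodicPts f, i ∈ R := fun i hi => by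
    obtain ⟨j, -, rfl⟩ := hbij.surjOn hi
    exact hfR j
  obtain ⟨c, hc⟩ : (periodicPts f).Nonempty := by
    obtain ⟨x, -⟩ := hR
    obtain ⟨m, n, hne, hmn⟩ := Finite.exists_ne_map_eq_of_infinite fun n : ℕ => f^[n] x
    wlog hlt : m < n generalizing m n
    · exact this n m hne.symm hmn.symm (by omega)
    refine ⟨f^[m] x, mk_mem_periodicPts (Nat.sub_pos_of_lt hlt) ?_⟩
    change f^[n - m] (f^[m] x) = f^[m] x
    rw [← iterate_add_apply, Nat.sub_add_cancel hlt.le]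
    exact hmn.symm
  set R' := R.filter (· ∉ periodicPts f) with hR'
  obtain ⟨a', hfix, hcore⟩ := ih R' (Finset.filter_ssubset.2 ⟨c, hCR c hc, by simpa using hc⟩)
  let σ : Equiv.Perm N := Equiv.Perm.ofSubtype (p := (· ∈ periodicPts f)) hbij.equiv
  have haC : ∀ i ∈ periodicPts f, (σ * a') i = f i := fun i hi => by
    rw [Equiv.Perm.mul_apply, hfix i (by simp [hR', hi])]
    exact Equiv.Perm.ofSubtype_apply_of_mem _ hi
  have haN : ∀ i ∉ periodicPts f, (σ * a') i = a' i := fun i hi => by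
    refine Equiv.Perm.ofSubtype_apply_of_not_mem _ fun h => hi ?_
    have := a'.injective (hfix (a' i) (by simp [hR', h]))
    rwa [this] at h
  refine ⟨σ * a', fun i hi => ?_, fun S b hSR hbS hba => ?_⟩
  · rw [haN i fun h => hi (hCR i h)]
    exact hfix i (by simp [hR', hi])
  have hbC : ∀ i ∈ S, i ∈ periodicPts f → b i = f i := fun i hi hiC => by
    have h := hba i hi
    rw [haC i hiC] at h
    rcases h with h | h
    · exact h
    · exact (hftop i _ (hSR (hbS i hi))).resolve_right fun h' =>
        (dem i).irrefl _ ((dem i).trans _ _ _ h h')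
  set T := S.filter (· ∈ periodicPts f) with hT
  have hsurj : Set.SurjOn b T T := by
    refine Finset.surjOn_of_injOn_of_card_le b (fun i hi => ?_) b.injective.injOn le_rfl
    simp only [hT, Finset.coe_filter, Set.mem_ofPred_eq] at hi ⊢
    exact ⟨hbS i hi.1, hbC i hi.1 hi.2 ▸ hbij.mapsTo hi.2⟩
  intro i hi
  by_cases hiC : i ∈ periodicPts f
  · rw [hbC i hi hiC, haC i hiC]
  · rw [haN i hiC]
    refine hcore (S.filter (· ∉ periodicPts f)) b ?_ ?_ ?_ i (by simp [hi, hiC])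
    · exact Finset.filter_subset_filter _ hSR
    · simp only [Finset.mem_filter]
      refine fun j hj => ⟨hbS j hj.1, fun h => hj.2 ?_⟩
      obtain ⟨k, hk, hkj⟩ := hsurj (Finset.mem_filter.2 ⟨hbS j hj.1, h⟩)
      exact b.injective hkj ▸ (Finset.mem_filter.1 hk).2
    · simp only [Finset.mem_filter]
      intro j hj
      rw [← haN j hj.2]
      exact hba j hj.1

/-- Every finite strict demand lexicographic market has a strong core allocation. -/
theorem exists_strongCore [Finite N] [DecidableEq N] (P : N → SDemLexPref N) :
    ∃ a, SIsStrongCore P a := by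
  cases nonempty_fintype N
  obtain ⟨a, -, ha⟩ := exists_demand_core (fun i => (P i).dem) Finset.univ
  refine ⟨a, fun S => ?_⟩
  rintro ⟨-, b, hbS, hw, j, hj, hs⟩
  have hba := ha S b (Finset.subset_univ S)
    (fun i hi => hbS ▸ Finset.mem_image_of_mem b hi) fun i hi => by
      rcases hw i hi with (h | h) | h
      · exact .inr h
      · exact .inl h.1
      · exact .inl h.1
  have hsymm : b.symm j = a.symm j := by
    rw [← hbS, Finset.mem_image] at hj
    obtain ⟨k, hk, rfl⟩ := hj
    rw [b.symm_apply_apply, hba k hk, a.symm_apply_apply]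
  rcases hs with h | h
  · exact (P j).dem.irrefl _ (hba j hj ▸ h)
  · exact (P j).sup.irrefl _ (hsymm ▸ h.2)

end StrongCoreExistence

/-- The strict linear order in which smaller values of the injective ranking `r` are better. -/
def SLO.ofRank (r : N → ℕ) (hr : Injective r) : SLO N where
  pref a b := r a < r b
  trichotomous a b := by
    rcases lt_trichotomy (r a) (r b) with h | h | h
    · exact .inl h
    · exact .inr (.inl (hr h))
    · exact .inr (.inr h)
  irrefl a := lt_irrefl _
  trans _ _ _ := lt_trans

/-- A market in which the three-cycle `finRotate 3` is a strong core allocation although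
agents `0` and `1` rank each other's houses first. -/
def cyclicMarket : Fin 3 → SDemLexPref (Fin 3) :=
  ![⟨.ofRank ![2, 0, 1] (by decide), .ofRank ![2, 1, 0] (by decide)⟩,
    ⟨.ofRank ![0, 2, 1] (by decide), .ofRank ![0, 1, 2] (by decide)⟩,
    ⟨.ofRank ![0, 1, 2] (by decide), .ofRank ![1, 0, 2] (by decide)⟩]

/-- Agent `1`'s manipulation at `cyclicMarket`: rank the own house second. -/
def truncatedPref : SDemLexPref (Fin 3) :=
  ⟨.ofRank ![0, 1, 2] (by decide), .ofRank ![0, 1, 2] (by decide)⟩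

theorem finRotate_strongCore : SIsStrongCore cyclicMarket (finRotate 3) := by
  unfold SIsStrongCore SWeaklyBlocks SDemLexPref.WPref SDemLexPref.SPref
  have hd : ∀ i a b, (cyclicMarket i).dem.pref a b ↔
      (![![2, 0, 1], ![0, 2, 1], ![0, 1, 2]] : Fin 3 → Fin 3 → ℕ) i a <
        (![![2, 0, 1], ![0, 2, 1], ![0, 1, 2]] : Fin 3 → Fin 3 → ℕ) i b := by
    intro i a b; fin_cases i <;> rfl
  have hs : ∀ i a b, (cyclicMarket i).sup.pref a b ↔
      (![![2, 1, 0], ![0, 1, 2], ![1, 0, 2]] : Fin 3 → Fin 3 → ℕ) i a <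
        (![![2, 1, 0], ![0, 1, 2], ![1, 0, 2]] : Fin 3 → Fin 3 → ℕ) i b := by
    intro i a b; fin_cases i <;> rfl
  simp only [hd, hs]
  decide +kernel

theorem strongCore_truncated {a : Equiv.Perm (Fin 3)}
    (ha : SIsStrongCore (update cyclicMarket 1 truncatedPref) a) : a 1 = 0 := by
  revert a
  unfold SIsStrongCore SWeaklyBlocks SDemLexPref.WPref SDemLexPref.SPref
  have hd : ∀ i a b, (update cyclicMarket 1 truncatedPref i).dem.pref a b ↔
      (![![2, 0, 1], ![0, 1, 2], ![0, 1, 2]] : Fin 3 → Fin 3 → ℕ) i a <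
        (![![2, 0, 1], ![0, 1, 2], ![0, 1, 2]] : Fin 3 → Fin 3 → ℕ) i b := by
    intro i a b; fin_cases i <;> rfl
  have hs : ∀ i a b, (update cyclicMarket 1 truncatedPref i).sup.pref a b ↔
      (![![2, 1, 0], ![0, 1, 2], ![1, 0, 2]] : Fin 3 → Fin 3 → ℕ) i a <
        (![![2, 1, 0], ![0, 1, 2], ![1, 0, 2]] : Fin 3 → Fin 3 → ℕ) i b := by
    intro i a b; fin_cases i <;> rfl
  simp only [hd, hs]
  decide +kernel

/-- With three agents there is a rule that always selects a strong core
allocation but is not strategy-proof; hence a strong-core selecting rule need not satisfy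
the conjunction of individual rationality, pair efficiency and strategy-proofness. -/
theorem strongCore_selection_not_strategyProof :
    ∃ φ : (Fin 3 → SDemLexPref (Fin 3)) → Equiv.Perm (Fin 3),
      (∀ P, SIsStrongCore P (φ P)) ∧
      ¬ (∀ (P : Fin 3 → SDemLexPref (Fin 3)) (i : Fin 3) (P' : SDemLexPref (Fin 3)),
          (P i).WPref i (φ P) (φ (Function.update P i P'))) ∧
      ¬ ((∀ P, SIndRational P (φ P)) ∧ (∀ P, SPairEff P (φ P)) ∧
          (∀ (P : Fin 3 → SDemLexPref (Fin 3)) (i : Fin 3) (P' : SDemLexPref (Fin 3)),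
            (P i).WPref i (φ P) (φ (Function.update P i P')))) := by
  obtain ⟨φ, hcore, hφ⟩ : ∃ φ : (Fin 3 → SDemLexPref (Fin 3)) → Equiv.Perm (Fin 3),
      (∀ P, SIsStrongCore P (φ P)) ∧ φ cyclicMarket = finRotate 3 := by
    choose ψ hψ using exists_strongCore (N := Fin 3)
    refine ⟨update ψ cyclicMarket (finRotate 3), fun P => ?_, update_self ..⟩
    by_cases h : P = cyclicMarket
    · rw [h, update_self]
      exact finRotate_strongCore
    · rw [update_of_ne h]
      exact hψ P
  have hsp : ¬ ∀ (P : Fin 3 → SDemLexPref (Fin 3)) (i : Fin 3) (P' : SDemLexPref (Fin 3)),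
      (P i).WPref i (φ P) (φ (update P i P')) := fun h => by
    have h1 := h cyclicMarket 1 truncatedPref
    have h0 := strongCore_truncated (hcore (update cyclicMarket 1 truncatedPref))
    have h2 : finRotate 3 1 = 2 := by decide
    rw [SDemLexPref.WPref, SDemLexPref.SPref, hφ, h0, h2] at h1
    rcases h1 with (h1 | h1) | h1
    · exact absurd (show 1 < 0 from h1) (by decide)
    · exact absurd h1.1 (by decide)
    · exact absurd h1.1 (by decide)
  exact ⟨φ, hcore, hsp, fun h => hsp h.2.2⟩
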